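/- Let G be a simple graph, let H be the clique substitution of G, and suppose H contains an induced path on m ≥ 1 vertices. Then G contains a (not necessarily induced) path on at least ⌈m/2⌉ vertices. -/

import Mathlib

/-- The clique substitution of a simple graph `G`: the vertex set is
`{(v,u) : v ∈ V(G), u ∈ N_G(v)}`; two distinct vertices are adjacent iff they
have the same first coordinate (the cliques `K^v`), or they are `(u,v)` and
`(v,u)` for an edge `uv` of `G`. -/
def cliqueSub {V : Type*} (G : SimpleGraph V) :
    SimpleGraph {p : V × V // G.Adj p.1 p.2} :=
  SimpleGraph.fromRel (fun a b => a.1.1 = b.1.1 ∨ (a.1.1 = b.1.2 ∧ a.1.2 = b.1.1))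

theorem cliqueSub_adj {V : Type*} (G : SimpleGraph V) (a b : {p : V × V // G.Adj p.1 p.2}) :
    (cliqueSub G).Adj a b ↔ a ≠ b ∧ ((a.1.1 = b.1.1 ∨ (a.1.1 = b.1.2 ∧ a.1.2 = b.1.1)) ∨
      (b.1.1 = a.1.1 ∨ (b.1.1 = a.1.2 ∧ b.1.2 = a.1.1))) :=
  Iff.rfl

/-- A sequence of vertices whose consecutive terms are equal or adjacent, and whose only
repetitions are between consecutive terms, visits a path containing at least half its terms. -/
theorem SimpleGraph.exists_isPath_of_lazy_walk {V : Type*} (G : SimpleGraph V) (m : ℕ) (f : ℕ → V)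
    (hadj : ∀ i, i + 1 < m → f i = f (i + 1) ∨ G.Adj (f i) (f (i + 1)))
    (hinj : ∀ i j, i < j → j < m → f i = f j → j = i + 1) (k : ℕ) (hk : k < m) :
    ∃ w : G.Walk (f k) (f 0), w.IsPath ∧ (∀ v ∈ w.support, ∃ j ≤ k, f j = v) ∧
      k + 1 ≤ 2 * (w.length + 1) ∧
      ((∃ j, k = j + 1 ∧ f j = f k) ∨ k + 2 ≤ 2 * (w.length + 1)) := by
  induction k with
  | zero => exact ⟨.nil, by simp, by simp, by simp, by simp⟩
  | succ k ih =>
    obtain ⟨w, hw, hsupp, hlen, hlen'⟩ := ih (by omega)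
    by_cases heq : f k = f (k + 1)
    · refine ⟨w.copy heq rfl, by simpa using hw, fun v hv => ?_, ?_, .inl ⟨k, rfl, heq⟩⟩
      · obtain ⟨j, hj, rfl⟩ := hsupp v (by simpa using hv)
        exact ⟨j, by omega, rfl⟩
      · rw [SimpleGraph.Walk.length_copy]
        rcases hlen' with ⟨j, rfl, hj⟩ | h
        · have := hinj j (j + 1 + 1) (by omega) hk (hj.trans heq)
          omega
        · omega
    · have ha := ((hadj k hk).resolve_left heq).symm
      refine ⟨.cons ha w, ?_, fun v hv => ?_, ?_, .inr ?_⟩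
      · refine hw.cons fun hmem => ?_
        obtain ⟨j, hj, hfj⟩ := hsupp _ hmem
        obtain rfl : k = j := by simpa using hinj j (k + 1) (by omega) hk hfj
        exact heq hfj
      · rw [SimpleGraph.Walk.support_cons, List.mem_cons] at hv
        rcases hv with rfl | hv
        · exact ⟨k + 1, le_rfl, rfl⟩
        · obtain ⟨j, hj, rfl⟩ := hsupp v hv
          exact ⟨j, by omega, rfl⟩
      all_goals
        rw [SimpleGraph.Walk.length_cons]
        omega

theorem stmt_7 {V : Type*} (G : SimpleGraph V) (m : ℕ) (hm : 1 ≤ m)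
    (hind : Nonempty (SimpleGraph.pathGraph m ↪g cliqueSub G)) :
    ∃ (a b : V) (w : G.Walk a b), w.IsPath ∧ (m + 1) / 2 ≤ w.length + 1 := by
  obtain ⟨φ⟩ := hind
  let e : ℕ → Fin m := fun i => ⟨min i (m - 1), by omega⟩
  have he : ∀ i j, i < j → j < m →
      ((cliqueSub G).Adj (φ (e i)) (φ (e j)) ↔ j = i + 1) := by
    intro i j hij hj
    rw [φ.map_adj_iff, SimpleGraph.pathGraph_adj]
    simp only [e]
    omega
  have hne : ∀ i j, i < j → j < m → φ (e i) ≠ φ (e j) := by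
    intro i j hij hj h
    have := congrArg Fin.val (φ.injective h)
    simp only [e] at this
    omega
  obtain ⟨w, hw, -, hlen, -⟩ := G.exists_isPath_of_lazy_walk m (fun i => (φ (e i)).1.1)
    (fun i hi => by
      have h := (he i (i + 1) (by omega) hi).2 rfl
      rw [cliqueSub_adj] at h
      have hi' := (φ (e i)).2
      rcases h.2 with (h | h) | (h | h)
      · exact .inl h
      · exact .inr (h.2 ▸ hi')
      · exact .inl h.symm
      · exact .inr (h.1 ▸ hi'))
    (fun i j hij hj h => (he i j hij hj).1 <| by
      rw [cliqueSub_adj]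
      exact ⟨hne i j hij hj, .inl (.inl h)⟩)
    (m - 1) (by omega)
  exact ⟨_, _, w, hw, by omega⟩
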